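/- arXiv:1309.7467 — 2 statements merged into one kernel-verified Lean document; each statement's English description precedes it below -/
import Mathlib

section
/- Let c ≥ 1, u ∈ Oˣ, and n ∈ Fˣ with j := v(n) satisfying 0 ≤ j ≤ c. Let f₀ : M₂(F) → ℂ be the indicator of {z : z₁₁, z₁₂, z₂₂ ∈ O, z₂₁ ∈ ϖᶜO}. Then for every x ∈ M₂(F): ∫_{M₂(F)} ( ∫_{M₂(F)} f₀(z)·ψ(u⟨y,z⟩) dz ) · ψ(−u·n·det y) · ψ(−u⟨x,y⟩) dy = q^{j−c} · ψ(−u·x₁₂·x₂₁/n) · 𝟙[x₁₁ ∈ O, x₁₂ ∈ ϖ^{j−c}O, x₂₁ ∈ ϖʲO, x₂₂ ∈ O]. (Here the inner Fourier transform of f₀ equals q^{−c} times the indicator of {y : y₁₁, y₂₁, y₂₂ ∈ O, y₁₂ ∈ ϖ^{−c}O}, so the outer integral is over a compact set; this identity computes the Weil-representation action of [[1,0],[n,1]] = −ω[[1,−n],[0,1]]ω on the Schwartz function f₀, which is invariant under K₁(ϖᶜ).) -/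
open MeasureTheory

/-- The fractional ideal of valuation at least `m`. -/
def Bl {F : Type*} [Field F] (v : F → ℤ) (m : ℤ) : Set F := {x : F | x = 0 ∨ m ≤ v x}

/-- The standing hypotheses of the main theorem. -/
structure LF {F : Type*} [Field F] [MeasurableSpace F] (v : F → ℤ) (q : ℕ)
    (μ : Measure F) (ψ : F → ℂ) : Prop where
  hq : 2 ≤ q
  hvmul : ∀ x y : F, x ≠ 0 → y ≠ 0 → v (x * y) = v x + v y
  hvadd : ∀ x y : F, x ≠ 0 → y ≠ 0 → x + y ≠ 0 → min (v x) (v y) ≤ v (x + y)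
  haar : ∀ a : F, MeasurePreserving (fun x => a + x) μ μ
  hball : ∀ m : ℤ, μ (Bl v m) = (q : ENNReal) ^ (-m)
  hmb : ∀ m : ℤ, MeasurableSet (Bl v m)
  hψadd : ∀ x y : F, ψ (x + y) = ψ x * ψ y
  hψ1 : ∀ x : F, x ∈ Bl v 0 → ψ x = 1
  hψnt : ∃ x : F, x ≠ 0 ∧ -1 ≤ v x ∧ ψ x ≠ 1

namespace LF

variable {F : Type*} [Field F] [MeasurableSpace F] {v : F → ℤ} {q : ℕ}
    {μ : Measure F} {ψ : F → ℂ}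

theorem v_one (H : LF v q μ ψ) : v 1 = 0 := by
  have := H.hvmul 1 1 one_ne_zero one_ne_zero
  simp at this; exact this

theorem v_neg (H : LF v q μ ψ) (x : F) : v (-x) = v x := by
  by_cases hx : x = 0
  · simp [hx]
  have h1 : v (-1) = 0 := by
    have := H.hvmul (-1) (-1) (by simp) (by simp)
    simp [H.v_one] at this; omega
  have := H.hvmul (-1) x (by simp) hx
  simpa [h1] using this

theorem v_div (H : LF v q μ ψ) (x y : F) (hx : x ≠ 0) (hy : y ≠ 0) : v (x / y) = v x - v y := by
  have := H.hvmul (x / y) y (div_ne_zero hx hy) hy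
  rw [div_mul_cancel₀ _ hy] at this; omega

theorem zero_mem (m : ℤ) : (0 : F) ∈ Bl v m := Or.inl rfl

theorem neg_mem (H : LF v q μ ψ) {m : ℤ} {x : F} (hx : x ∈ Bl v m) : -x ∈ Bl v m := by
  rcases hx with hx | hx
  · left; simp [hx]
  · right; rwa [H.v_neg]

theorem neg_mem_iff (H : LF v q μ ψ) {m : ℤ} {x : F} : -x ∈ Bl v m ↔ x ∈ Bl v m :=
  ⟨fun h => by simpa using H.neg_mem h, H.neg_mem⟩

theorem add_mem (H : LF v q μ ψ) {m : ℤ} {x y : F} (hx : x ∈ Bl v m) (hy : y ∈ Bl v m) :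
    x + y ∈ Bl v m := by
  by_cases x0 : x = 0
  · simpa [x0] using hy
  by_cases y0 : y = 0
  · simpa [y0] using hx
  by_cases h0 : x + y = 0
  · exact Or.inl h0
  have := H.hvadd x y x0 y0 h0
  rcases hx with hx | hx
  · exact absurd hx x0
  rcases hy with hy | hy
  · exact absurd hy y0
  right
  omega

theorem mono {m k : ℤ} (h : k ≤ m) {x : F} (hx : x ∈ Bl v m) : x ∈ Bl v k :=
  hx.imp id (fun h' => h.trans h')

theorem mul_mem (H : LF v q μ ψ) {m k : ℤ} {x y : F} (hx : x ∈ Bl v m) (hy : y ∈ Bl v k) :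
    x * y ∈ Bl v (m + k) := by
  by_cases x0 : x = 0
  · left; simp [x0]
  by_cases y0 : y = 0
  · left; simp [y0]
  rcases hx with hx | hx
  · exact absurd hx x0
  rcases hy with hy | hy
  · exact absurd hy y0
  right
  rw [H.hvmul x y x0 y0]; omega

theorem mul_mem_iff (H : LF v q μ ψ) {m : ℤ} {a x : F} (ha : a ≠ 0) :
    a * x ∈ Bl v m ↔ x ∈ Bl v (m - v a) := by
  by_cases x0 : x = 0
  · simp [x0, Bl]
  simp only [Bl, Set.mem_ofPred_eq, mul_eq_zero, ha, x0, false_or, H.hvmul a x ha x0]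
  omega

theorem add_mem_iff (H : LF v q μ ψ) {m : ℤ} {x t : F} (ht : t ∈ Bl v m) :
    t + x ∈ Bl v m ↔ x ∈ Bl v m :=
  ⟨fun h => by simpa using H.add_mem (H.neg_mem ht) h, H.add_mem ht⟩

theorem integral_add (H : LF v q μ ψ) (f : F → ℂ) (t : F) :
    ∫ x, f (t + x) ∂μ = ∫ x, f x ∂μ := by
  let e : F ≃ᵐ F := 
    { toEquiv := Equiv.addLeft t
      measurable_toFun := (H.haar t).measurable
      measurable_invFun := (H.haar (-t)).measurable }
  have h : MeasurePreserving e μ μ := H.haar t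
  exact h.integral_comp' f

theorem psi_zero (H : LF v q μ ψ) : ψ 0 = 1 := H.hψ1 0 (zero_mem 0)

theorem psi_nsmul (H : LF v q μ ψ) (N : ℕ) (x : F) : ψ (N • x) = ψ x ^ N := by
  induction N with
  | zero => simp [H.psi_zero]
  | succ k ih => rw [succ_nsmul, H.hψadd, ih, pow_succ]

theorem q_ne (H : LF v q μ ψ) : (q : ENNReal) ≠ 0 := by
  have := H.hq
  simp; omega

theorem ball_pos (H : LF v q μ ψ) (m : ℤ) : 0 < μ (Bl v m) := by
  rw [H.hball]
  exact ENNReal.zpow_pos H.q_ne (by simp) _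

theorem ball_lt (H : LF v q μ ψ) (m : ℤ) : μ (Bl v m) < ⊤ := by
  rw [H.hball]
  exact ENNReal.zpow_lt_top H.q_ne (by simp) _

theorem ball_real (H : LF v q μ ψ) (m : ℤ) : μ.real (Bl v m) = (q : ℝ) ^ (-m) := by
  rw [Measure.real, H.hball]
  generalize -m = k
  cases k with
  | ofNat k => simp
  | negSucc k => simp [zpow_negSucc, ENNReal.toReal_inv]

theorem psi_norm (H : LF v q μ ψ) (x : F) : ‖ψ x‖ = 1 := by
  obtain ⟨N, hN, hx⟩ : ∃ N : ℕ, N ≠ 0 ∧ N • x ∈ Bl v 0 := by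
    by_contra! hcon
    have hk : ∀ k : ℕ, k • x ∈ Bl v (min 0 (v x)) := by
      intro k
      induction k with
      | zero => simpa using zero_mem _
      | succ k ih => rw [succ_nsmul]; exact H.add_mem ih (Or.inr (min_le_right _ _))
    have hfin := Measure.finite_const_le_meas_of_disjoint_iUnion μ (H.ball_pos 0)
      (As := fun k : ℕ => (fun y => -(k • x) + y) ⁻¹' (Bl v 0))
      (fun k => (H.haar _).measurable (H.hmb 0)) ?_ ?_
    · have : {i : ℕ | μ (Bl v 0) ≤ μ ((fun y => -(i • x) + y) ⁻¹' (Bl v 0))} = Set.univ := by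
        ext i
        have h := (H.haar (-(i • x))).measure_preimage (H.hmb 0).nullMeasurableSet
        exact ⟨fun _ => trivial, fun _ => h.ge⟩
      rw [this] at hfin
      exact Set.infinite_univ hfin
    · have key : ∀ i j : ℕ, i < j → Disjoint ((fun y => -(i • x) + y) ⁻¹' (Bl v 0))
          ((fun y => -(j • x) + y) ⁻¹' (Bl v 0)) := by
        intro i j hij
        rw [Set.disjoint_left]
        intro y hi hj
        apply hcon (j - i) (by omega)
        have := H.add_mem hi (H.neg_mem hj)
        convert this using 1
        rw [sub_nsmul _ hij.le]
        ring
      intro i j hij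
      rcases lt_or_gt_of_ne hij with h | h
      · exact key i j h
      · exact (key j i h).symm
    · refine ((measure_mono ?_).trans_lt (H.ball_lt (min 0 (v x)))).ne
      intro y hy
      simp only [Set.mem_iUnion, Set.mem_preimage] at hy
      obtain ⟨k, hy⟩ := hy
      have := H.add_mem (hk k) (mono (min_le_left _ _) hy)
      simpa using this
  have h1 : ‖ψ x‖ ^ N = 1 := by
    rw [← norm_pow, ← H.psi_nsmul, H.hψ1 _ hx, norm_one]
  exact (pow_eq_one_iff_of_nonneg (norm_nonneg _) hN).1 h1

theorem exists_nt (H : LF v q μ ψ) {a : F} {m : ℤ} (h : a ∉ Bl v (-m)) :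
    ∃ t ∈ Bl v m, ψ (a * t) ≠ 1 := by
  obtain ⟨x, hx0, hxv, hx⟩ := H.hψnt
  simp only [Bl, Set.mem_ofPred_eq, not_or, not_le] at h
  refine ⟨x / a, Or.inr ?_, ?_⟩
  · rw [H.v_div _ _ hx0 h.1]; omega
  · rwa [mul_div_cancel₀ _ h.1]

open Classical in
theorem int_ball (H : LF v q μ ψ) (a : F) (m : ℤ) :
    ∫ x, (Bl v m).indicator (fun x => ψ (a * x)) x ∂μ
      = (Bl v (-m)).indicator (fun _ => (q : ℂ) ^ (-m)) a := by
  by_cases h : a ∈ Bl v (-m)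
  · rw [Set.indicator_of_mem h]
    have : (Bl v m).indicator (fun x => ψ (a * x)) = (Bl v m).indicator (fun x => (1 : ℂ)) := by
      apply Set.indicator_congr
      intro x hx
      apply H.hψ1
      simpa using H.mul_mem h hx
    rw [this, integral_indicator_const _ (H.hmb m), H.ball_real]
    simp
  · rw [Set.indicator_of_notMem h]
    obtain ⟨t, ht, hne⟩ := H.exists_nt h
    have h1 := H.integral_add ((Bl v m).indicator (fun x => ψ (a * x))) t
    have h2 : ∀ x, (Bl v m).indicator (fun x => ψ (a * x)) (t + x)
        = ψ (a * t) * (Bl v m).indicator (fun x => ψ (a * x)) x := by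
      intro x
      simp only [Set.indicator_apply, H.add_mem_iff ht, mul_add, H.hψadd]
      split_ifs <;> simp
    simp only [h2, integral_const_mul] at h1
    exact (mul_left_eq_self₀.1 h1).resolve_left hne

/-- The ball as an additive subgroup. -/
def sub (H : LF v q μ ψ) (m : ℤ) : AddSubgroup F where
  carrier := Bl v m
  zero_mem' := zero_mem m
  add_mem' := H.add_mem
  neg_mem' := H.neg_mem

theorem mem_sub (H : LF v q μ ψ) (m : ℤ) (x : F) : x ∈ H.sub m ↔ x ∈ Bl v m := Iff.rfl

theorem fiber (H : LF v q μ ψ) (m : ℤ) (z : F ⧸ H.sub m) :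
    (fun x : F => (x : F ⧸ H.sub m)) ⁻¹' {z} = (fun x => -z.out + x) ⁻¹' (Bl v m) := by
  ext x
  simp only [Set.mem_preimage, Set.mem_singleton_iff]
  rw [← H.mem_sub, ← QuotientAddGroup.eq]
  have h : ((z.out : F) : F ⧸ H.sub m) = z := Quotient.out_eq' z
  rw [h]
  exact eq_comm

theorem fiber_meas (H : LF v q μ ψ) (m : ℤ) (z : F ⧸ H.sub m) :
    MeasurableSet ((fun x : F => (x : F ⧸ H.sub m)) ⁻¹' {z}) := by
  rw [H.fiber]; exact (H.haar _).measurable (H.hmb m)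

theorem countable (H : LF v q μ ψ) [SigmaFinite μ] (m : ℤ) : Countable (F ⧸ H.sub m) := by
  have := Measure.countable_meas_pos_of_disjoint_iUnion (μ := μ) (H.fiber_meas m)
    (by
      intro i j hij
      exact Disjoint.preimage _ (by simpa using hij))
  rw [← Set.countable_univ_iff]
  convert this
  ext z
  refine ⟨fun _ => ?_, fun _ => trivial⟩
  change 0 < μ ((fun x : F => (x : F ⧸ H.sub m)) ⁻¹' {z})
  rw [H.fiber, (H.haar (-z.out)).measure_preimage (H.hmb m).nullMeasurableSet]
  exact H.ball_pos m

theorem meas2 (H : LF v q μ ψ) [SigmaFinite μ] (m : ℤ) (f : F → F → ℂ)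
    (hf : ∀ a a' b b', -a + a' ∈ Bl v m → -b + b' ∈ Bl v m → f a b = f a' b') :
    Measurable (fun p : F × F => f p.1 p.2) := by
  let _ : MeasurableSpace (F ⧸ H.sub m) := ⊤
  have : DiscreteMeasurableSpace (F ⧸ H.sub m) := ⟨fun _ => trivial⟩
  have := H.countable m
  have hmk : Measurable (fun x : F => (x : F ⧸ H.sub m)) := measurable_to_countable' (H.fiber_meas m)
  have hg : Measurable (fun p : (F ⧸ H.sub m) × (F ⧸ H.sub m) => f p.1.out p.2.out) :=
    Measurable.of_discrete
  have := hg.comp ((hmk.comp measurable_fst).prodMk (hmk.comp measurable_snd))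
  convert this using 1
  ext p
  apply hf
  · rw [← H.mem_sub, ← QuotientAddGroup.eq]; exact (Quotient.out_eq' _).symm
  · rw [← H.mem_sub, ← QuotientAddGroup.eq]; exact (Quotient.out_eq' _).symm

theorem meas_psi (H : LF v q μ ψ) [SigmaFinite μ] (a : F) : Measurable (fun x => ψ (a * x)) := by
  have := H.meas2 (-v a) (fun x _ => ψ (a * x)) (by
    intro x x' _ _ h _
    have e : x' = x + (-x + x') := by ring
    have h0 : a * (-x + x') ∈ Bl v 0 := by
      have := H.mul_mem (x := a) (m := v a) (Or.inr le_rfl) h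
      simpa using this
    rw [e, mul_add, H.hψadd, H.hψ1 _ h0, mul_one])
  exact this.comp (measurable_id.prodMk (measurable_const (a := (0 : F))))

theorem meas_T (H : LF v q μ ψ) [SigmaFinite μ] (n : F) (c : ℤ) (hc : 0 ≤ c) (hn : n ∈ Bl v 0) :
    Measurable (fun p : F × F => (Bl v (-c)).indicator (fun _ => (1:ℂ)) p.1 *
      ((Bl v 0).indicator (fun _ => (1:ℂ)) p.2 * ψ (n * p.1 * p.2))) := by
  apply H.meas2 c (fun a b => (Bl v (-c)).indicator (fun _ => (1:ℂ)) a *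
      ((Bl v 0).indicator (fun _ => (1:ℂ)) b * ψ (n * a * b)))
  classical
  intro a a' b b' ha hb
  obtain ⟨s, rfl⟩ : ∃ s, a' = s + a := ⟨-a + a', by ring⟩
  obtain ⟨t, rfl⟩ : ∃ t, b' = t + b := ⟨-b + b', by ring⟩
  have hs : s ∈ Bl v c := by simpa [add_comm s a] using ha
  have ht : t ∈ Bl v c := by simpa [add_comm t b] using hb
  have hs' := mono (k := -c) (by omega) hs
  have ht' := mono (k := 0) (by omega) ht
  simp only [Set.indicator_apply, H.add_mem_iff hs', H.add_mem_iff ht']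
  split_ifs with h1 h2
  · have e : n * (s + a) * (t + b) = n * a * b + n * (s * (t + b) + a * t) := by ring
    have : n * (s * (t + b) + a * t) ∈ Bl v 0 := by
      have h3 := mono (k := 0) (by omega) (H.mul_mem hs (H.add_mem ht' h2))
      have h4 := H.mul_mem h1 ht
      rw [neg_add_cancel] at h4
      simpa using H.mul_mem hn (H.add_mem h3 h4)
    rw [e, H.hψadd, H.hψ1 _ this]; simp
  all_goals simp

theorem pi_integral [SigmaFinite μ] (f : (F × F) × (F × F) → ℂ) :
    ∫ y : Fin 2 → Fin 2 → F, f ((y 0 0, y 0 1), (y 1 0, y 1 1))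
      ∂(Measure.pi fun _ : Fin 2 => Measure.pi fun _ : Fin 2 => μ)
    = ∫ p, f p ∂((μ.prod μ).prod (μ.prod μ)) := by
  have h1 := measurePreserving_finTwoArrow (μ)
  have h2 := measurePreserving_finTwoArrow (Measure.pi fun _ : Fin 2 => μ)
  rw [← (h1.prod h1).integral_comp (MeasurableEquiv.prodCongr MeasurableEquiv.finTwoArrow MeasurableEquiv.finTwoArrow).measurableEmbedding f, ← h2.integral_comp']
  rfl

theorem inner_int [SigmaFinite μ] (f g h k : F → ℂ) :
    ∫ z : Fin 2 → Fin 2 → F, (f (z 0 0) * g (z 0 1)) * (h (z 1 0) * k (z 1 1))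
      ∂(Measure.pi fun _ : Fin 2 => Measure.pi fun _ : Fin 2 => μ)
    = ((∫ x, f x ∂μ) * ∫ x, g x ∂μ) * ((∫ x, h x ∂μ) * ∫ x, k x ∂μ) := by
  rw [pi_integral (fun p : (F × F) × (F × F) => (f p.1.1 * g p.1.2) * (h p.2.1 * k p.2.2))]
  rw [integral_prod_mul (fun p : F × F => f p.1 * g p.2) (fun p : F × F => h p.1 * k p.2),
    integral_prod_mul, integral_prod_mul]

theorem outer_int (H : LF v q μ ψ) [SigmaFinite μ] (n p r s t : F) (c : ℤ) (hc : 0 ≤ c)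
    (hn : n ∈ Bl v 0) :
    ∫ y : Fin 2 → Fin 2 → F, (Bl v 0).indicator (fun x => ψ (p * x)) (y 0 0) *
        (Bl v (-c)).indicator (fun x => ψ (r * x)) (y 0 1) *
        ((Bl v 0).indicator (fun x => ψ ((n * y 0 1 + s) * x)) (y 1 0) *
        (Bl v 0).indicator (fun x => ψ (t * x)) (y 1 1))
      ∂(Measure.pi fun _ : Fin 2 => Measure.pi fun _ : Fin 2 => μ)
    = (∫ x, (Bl v 0).indicator (fun x => ψ (p * x)) x ∂μ) *
      (∫ x, (Bl v (-c)).indicator (fun x => ψ (r * x)) x *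
        ∫ y, (Bl v 0).indicator (fun y => ψ ((n * x + s) * y)) y ∂μ ∂μ) *
      (∫ x, (Bl v 0).indicator (fun x => ψ (t * x)) x ∂μ) := by
  classical
  rw [pi_integral (fun y : (F × F) × (F × F) => (Bl v 0).indicator (fun x => ψ (p * x)) y.1.1 *
        (Bl v (-c)).indicator (fun x => ψ (r * x)) y.1.2 *
        ((Bl v 0).indicator (fun x => ψ ((n * y.1.2 + s) * x)) y.2.1 *
        (Bl v 0).indicator (fun x => ψ (t * x)) y.2.2)), integral_prod]
  · simp only [integral_const_mul]
    have : ∀ x : F × F, ∫ y : F × F, (Bl v 0).indicator (fun z => ψ ((n * x.2 + s) * z)) y.1 *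
        (Bl v 0).indicator (fun z => ψ (t * z)) y.2 ∂(μ.prod μ) =
        (∫ y, (Bl v 0).indicator (fun y => ψ ((n * x.2 + s) * y)) y ∂μ) *
        ∫ x, (Bl v 0).indicator (fun x => ψ (t * x)) x ∂μ := by
      intro x
      rw [integral_prod_mul]
    simp only [this]
    rw [← integral_prod_mul, ← integral_mul_const]
    congr 1
    ext x
    ring
  · have hm : ∀ (a : F) (m : ℤ), Measurable ((Bl v m).indicator (fun x => ψ (a * x))) :=
      fun a m => (H.meas_psi a).indicator (H.hmb m)
    have hle : ∀ (a : F) (m : ℤ) x, ‖(Bl v m).indicator (fun x => ψ (a * x)) x‖ ≤ 1 := by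
      intro a m x
      refine (norm_indicator_le_norm_self _ _).trans (H.psi_norm _).le
    rw [← integrableOn_iff_integrable_of_support_subset
      (s := ((Bl v 0) ×ˢ (Bl v (-c))) ×ˢ ((Bl v 0) ×ˢ (Bl v 0)))]
    · refine Measure.integrableOn_of_bounded (M := 1) ?_ ?_ ?_
      · rw [Measure.prod_prod, Measure.prod_prod, Measure.prod_prod]
        exact (ENNReal.mul_lt_top (ENNReal.mul_lt_top (H.ball_lt _) (H.ball_lt _))
          (ENNReal.mul_lt_top (H.ball_lt _) (H.ball_lt _))).ne
      · apply Measurable.aestronglyMeasurable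
        have hT := (H.meas_T n c hc hn).comp
          ((measurable_snd.comp measurable_fst).prodMk (measurable_fst.comp measurable_snd) :
            Measurable (fun y : (F × F) × (F × F) => (y.1.2, y.2.1)))
        have h1 := (hm p 0).comp
          (measurable_fst.comp measurable_fst : Measurable (fun y : (F × F) × (F × F) => y.1.1))
        have h2 := (hm r (-c)).comp
          (measurable_snd.comp measurable_fst : Measurable (fun y : (F × F) × (F × F) => y.1.2))
        have h3 := (hm s 0).comp
          (measurable_fst.comp measurable_snd : Measurable (fun y : (F × F) × (F × F) => y.2.1))
        have h4 := (hm t 0).comp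
          (measurable_snd.comp measurable_snd : Measurable (fun y : (F × F) × (F × F) => y.2.2))
        convert ((h1.mul h2).mul (h3.mul h4)).mul hT using 1
        ext y
        simp only [Function.comp, Pi.mul_apply, Set.indicator_apply, add_mul, H.hψadd]
        split_ifs <;> ring
      · refine Filter.Eventually.of_forall fun y => ?_
        rw [norm_mul, norm_mul, norm_mul]
        exact mul_le_one₀ (mul_le_one₀ (hle _ _ _) (norm_nonneg _) (hle _ _ _)) (by positivity)
          (mul_le_one₀ (hle _ _ _) (norm_nonneg _) (hle _ _ _))
    · intro y hy
      simp only [Function.mem_support, ne_eq, mul_eq_zero, not_or, Set.indicator_apply_eq_zero,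
        Classical.not_imp] at hy
      exact ⟨⟨hy.1.1.1, hy.1.2.1⟩, ⟨hy.2.1.1, hy.2.2.1⟩⟩

theorem mid_int (H : LF v q μ ψ) (n r s : F) (c : ℤ) (hn0 : n ≠ 0) (hnc : v n ≤ c) :
    (∫ x, (Bl v (-c)).indicator (fun x => ψ (r * x)) x *
        ∫ y, (Bl v 0).indicator (fun y => ψ ((n * x + s) * y)) y ∂μ ∂μ)
    = (Bl v (v n - c)).indicator (fun _ => (1 : ℂ)) s *
      ((Bl v (v n)).indicator (fun _ => (1 : ℂ)) r * ((q : ℂ) ^ (v n) * ψ (-(r * s / n)))) := by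
  classical
  simp only [H.int_ball]
  rw [← H.integral_add _ (-(s / n))]
  have hmem : ∀ x, n * (-(s / n) + x) + s ∈ Bl v (-0) ↔ x ∈ Bl v (-v n) := by
    intro x
    have : n * (-(s / n) + x) + s = n * x := by field_simp; ring
    rw [this, H.mul_mem_iff hn0]; simp
  have hs : s ∈ Bl v (v n - c) ↔ -(s / n) ∈ Bl v (-c) := by
    rw [H.neg_mem_iff]
    have h := H.mul_mem_iff (m := v n - c) (x := s / n) hn0
    rw [mul_div_cancel₀ _ hn0] at h
    rw [h]
    have e : v n - c - v n = -c := by ring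
    rw [e]
  have key : ∀ x, (Bl v (-c)).indicator (fun x => ψ (r * x)) (-(s / n) + x) *
      (Bl v (-0)).indicator (fun _ => (q : ℂ) ^ (-0 : ℤ)) (n * (-(s / n) + x) + s) =
      ((Bl v (v n - c)).indicator (fun _ => (1 : ℂ)) s * ψ (-(r * s / n))) *
        (Bl v (-v n)).indicator (fun x => ψ (r * x)) x := by
    intro x
    simp only [Set.indicator_apply, hmem, hs]
    by_cases hx : x ∈ Bl v (-v n)
    · rw [add_comm (-(s / n)) x, H.add_mem_iff (mono (by omega) hx)]
      have e : r * (x + -(s / n)) = -(r * s / n) + r * x := by ring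
      rw [e, H.hψadd]
      simp [hx]
    · simp [hx]
  simp only [key, integral_const_mul, H.int_ball]
  simp only [Set.indicator_apply, neg_neg]
  split_ifs <;> ring

end LF

/-- The Weil-representation action of `[[1,0],[n,1]] = −ω[[1,−n],[0,1]]ω`
on the Schwartz function `f₀ = 1_{[[O,O],[ϖᶜO,O]]}` (for fixed unit `u`), computed as the
double Fourier-type integral over `M₂(F)` (with the product Haar measure and the
determinant bilinear form `⟨x,y⟩ = x₁₁y₂₂ + x₂₂y₁₁ − x₁₂y₂₁ − x₂₁y₁₂`): it equals
`q^{j−c}·ψ(−u·x₁₂x₂₁/n)` times the indicator of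
`x₁₁ ∈ O, x₁₂ ∈ ϖ^{j−c}O, x₂₁ ∈ ϖʲO, x₂₂ ∈ O`, where `j = v(n)`, `0 ≤ j ≤ c`. -/
theorem stmt_16
    (F : Type*) [Field F] [MeasurableSpace F]
    (v : F → ℤ) (ϖ : F) (q : ℕ) (hq : 2 ≤ q)
    (hϖ0 : ϖ ≠ 0) (hϖv : v ϖ = 1)
    (hvmul : ∀ x y : F, x ≠ 0 → y ≠ 0 → v (x * y) = v x + v y)
    (hvadd : ∀ x y : F, x ≠ 0 → y ≠ 0 → x + y ≠ 0 → min (v x) (v y) ≤ v (x + y))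
    (μ : Measure F) [SigmaFinite μ]
    (haar : ∀ a : F, MeasurePreserving (fun x => a + x) μ μ)
    (hball : ∀ m : ℤ, μ {x : F | x = 0 ∨ m ≤ v x} = (q : ENNReal) ^ (-m))
    (hmb : ∀ m : ℤ, MeasurableSet {x : F | x = 0 ∨ m ≤ v x})
    (ψ : F → ℂ) (hψmeas : Measurable ψ)
    (hψadd : ∀ x y : F, ψ (x + y) = ψ x * ψ y)
    (hψ1 : ∀ x : F, (x = 0 ∨ 0 ≤ v x) → ψ x = 1)
    (hψnt : ∃ x : F, x ≠ 0 ∧ -1 ≤ v x ∧ ψ x ≠ 1)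
    (c : ℤ) (hc : 1 ≤ c)
    (u : F) (hu0 : u ≠ 0) (huv : v u = 0)
    (n : F) (hn0 : n ≠ 0) (hnv0 : 0 ≤ v n) (hnvc : v n ≤ c) :
    ∀ x : Fin 2 → Fin 2 → F,
      (∫ y, ((∫ z, Set.indicator
            {z : Fin 2 → Fin 2 → F |
              (z 0 0 = 0 ∨ 0 ≤ v (z 0 0)) ∧ (z 0 1 = 0 ∨ 0 ≤ v (z 0 1)) ∧
              (z 1 1 = 0 ∨ 0 ≤ v (z 1 1)) ∧ (z 1 0 = 0 ∨ c ≤ v (z 1 0))}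
            (fun z => ψ (u * (y 0 0 * z 1 1 + y 1 1 * z 0 0
              - y 0 1 * z 1 0 - y 1 0 * z 0 1))) z
            ∂(Measure.pi fun _ : Fin 2 => Measure.pi fun _ : Fin 2 => μ)) *
          ψ (-(u * n * (y 0 0 * y 1 1 - y 0 1 * y 1 0))) *
          ψ (-(u * (x 0 0 * y 1 1 + x 1 1 * y 0 0 - x 0 1 * y 1 0 - x 1 0 * y 0 1))))
        ∂(Measure.pi fun _ : Fin 2 => Measure.pi fun _ : Fin 2 => μ))
      = Set.indicator
          {x : Fin 2 → Fin 2 → F |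
            (x 0 0 = 0 ∨ 0 ≤ v (x 0 0)) ∧ (x 0 1 = 0 ∨ v n - c ≤ v (x 0 1)) ∧
            (x 1 0 = 0 ∨ v n ≤ v (x 1 0)) ∧ (x 1 1 = 0 ∨ 0 ≤ v (x 1 1))}
          (fun x => (q : ℂ) ^ (v n - c) * ψ (-(u * x 0 1 * x 1 0 / n))) x := by
  classical
  intro x
  have H : LF v q μ ψ := ⟨hq, hvmul, hvadd, haar, hball, hmb, hψadd, hψ1, hψnt⟩
  have hq0 : (q : ℂ) ≠ 0 := by
    have : q ≠ 0 := by omega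
    exact_mod_cast this
  have hun0 : u * n ≠ 0 := mul_ne_zero hu0 hn0
  have hvun : v (u * n) = v n := by rw [hvmul u n hu0 hn0, huv, zero_add]
  have hU : ∀ (m : ℤ) (a : F), u * a ∈ Bl v m ↔ a ∈ Bl v m := by
    intro m a
    rw [H.mul_mem_iff hu0, huv, sub_zero]
  have hB : ∀ (m : ℤ) (a : F), (a = 0 ∨ m ≤ v a) ↔ a ∈ Bl v m := fun _ _ => Iff.rfl
  -- the inner Fourier transform
  have hin : ∀ y : Fin 2 → Fin 2 → F, (∫ z, Set.indicator
            {z : Fin 2 → Fin 2 → F |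
              (z 0 0 = 0 ∨ 0 ≤ v (z 0 0)) ∧ (z 0 1 = 0 ∨ 0 ≤ v (z 0 1)) ∧
              (z 1 1 = 0 ∨ 0 ≤ v (z 1 1)) ∧ (z 1 0 = 0 ∨ c ≤ v (z 1 0))}
            (fun z => ψ (u * (y 0 0 * z 1 1 + y 1 1 * z 0 0
              - y 0 1 * z 1 0 - y 1 0 * z 0 1))) z
            ∂(Measure.pi fun _ : Fin 2 => Measure.pi fun _ : Fin 2 => μ)) =
      (q : ℂ) ^ (-c) * ((Bl v 0).indicator (fun _ => (1 : ℂ)) (y 0 0) *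
        (Bl v (-c)).indicator (fun _ => (1 : ℂ)) (y 0 1) *
        (Bl v 0).indicator (fun _ => (1 : ℂ)) (y 1 0) *
        (Bl v 0).indicator (fun _ => (1 : ℂ)) (y 1 1)) := by
    intro y
    have h := LF.inner_int (μ := μ) ((Bl v 0).indicator (fun x => ψ ((u * y 1 1) * x)))
      ((Bl v 0).indicator (fun x => ψ (-(u * y 1 0) * x)))
      ((Bl v c).indicator (fun x => ψ (-(u * y 0 1) * x)))
      ((Bl v 0).indicator (fun x => ψ ((u * y 0 0) * x)))
    simp only [H.int_ball] at h
    calc _ = _ := by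
          congr 1
          ext z
          have e : u * (y 0 0 * z 1 1 + y 1 1 * z 0 0 - y 0 1 * z 1 0 - y 1 0 * z 0 1)
            = (u * y 1 1) * z 0 0 + -(u * y 1 0) * z 0 1 + (-(u * y 0 1) * z 1 0
              + (u * y 0 0) * z 1 1) := by ring
          simp only [Set.indicator_apply, e, hψadd]
          simp only [Set.mem_ofPred_eq, hB]
          by_cases h1 : z 0 0 ∈ Bl v 0 <;> by_cases h2 : z 0 1 ∈ Bl v 0 <;>
          by_cases h3 : z 1 1 ∈ Bl v 0 <;> by_cases h4 : z 1 0 ∈ Bl v c <;> simp [h1, h2, h3, h4]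
      _ = _ := h
      _ = _ := by
          simp only [Set.indicator_apply, H.neg_mem_iff, hU, neg_zero, zpow_zero]
          split_ifs <;> simp
  simp only [hin]
  have hout := H.outer_int (u * n) (-(u * x 1 1)) (u * x 1 0) (u * x 0 1) (-(u * x 0 0)) c
    (by omega) (Or.inr (by omega))
  rw [H.mid_int _ _ _ _ hun0 (by omega), H.int_ball, H.int_ball] at hout
  calc _ = (q : ℂ) ^ (-c) * _ := by
        rw [← integral_const_mul]
        congr 1
        ext y
        rw [mul_assoc, mul_assoc]
        congr 1
        rw [← hψadd]
        by_cases h00 : y 0 0 ∈ Bl v 0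
        swap
        · simp [h00]
        by_cases h11 : y 1 1 ∈ Bl v 0
        swap
        · simp [h11]
        have hone : ψ (-(u * n * (y 0 0 * y 1 1))) = 1 := by
          apply hψ1
          apply H.neg_mem
          have h1 : u * n ∈ Bl v 0 := Or.inr (by omega)
          simpa using H.mul_mem h1 (H.mul_mem h00 h11)
        have e : -(u * n * (y 0 0 * y 1 1 - y 0 1 * y 1 0)) +
          -(u * (x 0 0 * y 1 1 + x 1 1 * y 0 0 - x 0 1 * y 1 0 - x 1 0 * y 0 1))
          = -(u * n * (y 0 0 * y 1 1)) + (-(u * x 1 1) * y 0 0 + u * x 1 0 * y 0 1 +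
            ((u * n * y 0 1 + u * x 0 1) * y 1 0 + -(u * x 0 0) * y 1 1)) := by ring
        rw [e, hψadd, hone, one_mul, hψadd, hψadd _ (u * x 1 0 * y 0 1),
          hψadd _ (-(u * x 0 0) * y 1 1)]
        simp only [Set.indicator_apply]
        split_ifs <;> simp
    _ = _ := congrArg _ hout
    _ = _ := by
        have e : u * x 1 0 * (u * x 0 1) / (u * n) = u * x 0 1 * x 1 0 / n := by
          field_simp
        rw [e, hvun]
        simp only [Set.indicator_apply, H.neg_mem_iff, hU, neg_zero, zpow_zero]
        simp only [Set.mem_ofPred_eq, hB]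
        rw [sub_eq_add_neg (v n) c, zpow_add₀ hq0]
        by_cases h1 : x 0 0 ∈ Bl v 0 <;> by_cases h2 : x 0 1 ∈ Bl v (v n + -c) <;>
          by_cases h3 : x 1 1 ∈ Bl v 0 <;> by_cases h4 : x 1 0 ∈ Bl v (v n) <;>
          simp [h1, h2, h3, h4]
        ring
end

section
/- Let c ≥ 1, u ∈ Oˣ, b₁, b₂ ∈ O, and n ∈ Fˣ with j := v(n) satisfying 0 ≤ j ≤ c. Let f : M₂(F) → ℂ be the indicator of {z : z₁₁ ∈ b₁+ϖᶜO, z₂₁ ∈ b₂+ϖᶜO, z₁₂ ∈ O, z₂₂ ∈ O}. Then for every x ∈ M₂(F): ∫_{M₂(F)} ( ∫_{M₂(F)} f(z)·ψ(u⟨y,z⟩) dz ) · ψ(−u·n·det y) · ψ(−u⟨x,y⟩) dy = q^{2(j−c)} · ψ( u·n⁻¹·[ (x₁₁−b₁)·x₂₂ − x₁₂·(x₂₁−b₂) ] ) · 𝟙[x₁₁ ∈ b₁+ϖʲO, x₂₁ ∈ b₂+ϖʲO, x₁₂ ∈ ϖ^{j−c}O, x₂₂ ∈ ϖ^{j−c}O].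 (The inner Fourier transform of f equals q^{−2c}·ψ(u(y₂₂b₁ − y₁₂b₂)) times the indicator of {y : y₁₁, y₂₁ ∈ O, y₁₂, y₂₂ ∈ ϖ^{−c}O}, so the outer integral is over a compact set; this computes the Weil-representation action of [[1,0],[n,1]] on f, which is invariant under the principal congruence-type subgroup K₁¹(ϖᶜ).) -/
open MeasureTheory

/-- Bundled hypotheses of the setting. -/
structure WSetup {F : Type*} [Field F] [MeasurableSpace F]
    (v : F → ℤ) (q : ℕ) (μ : Measure F) (ψ : F → ℂ) : Prop where
  hq : 2 ≤ q
  hvmul : ∀ x y : F, x ≠ 0 → y ≠ 0 → v (x * y) = v x + v y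
  hvadd : ∀ x y : F, x ≠ 0 → y ≠ 0 → x + y ≠ 0 → min (v x) (v y) ≤ v (x + y)
  haar : ∀ a : F, MeasurePreserving (fun x => a + x) μ μ
  hball : ∀ m : ℤ, μ {x : F | x = 0 ∨ m ≤ v x} = (q : ENNReal) ^ (-m)
  hmb : ∀ m : ℤ, MeasurableSet {x : F | x = 0 ∨ m ≤ v x}
  hψmeas : Measurable ψ
  hψadd : ∀ x y : F, ψ (x + y) = ψ x * ψ y
  hψ1 : ∀ x : F, (x = 0 ∨ 0 ≤ v x) → ψ x = 1
  hψnt : ∃ x : F, x ≠ 0 ∧ -1 ≤ v x ∧ ψ x ≠ 1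

open Classical in
/-- Characteristic function of the ball of valuation at least `m`. -/
noncomputable def wch {F : Type*} [Field F] (v : F → ℤ) (m : ℤ) (x : F) : ℂ :=
  if x = 0 ∨ m ≤ v x then 1 else 0

set_option linter.unusedSectionVars false

namespace WSetup

variable {F : Type*} [Field F] [MeasurableSpace F]
  {v : F → ℤ} {q : ℕ} {μ : Measure F} {ψ : F → ℂ}

theorem v_one (h : WSetup v q μ ψ) : v 1 = 0 := by
  have := h.hvmul 1 1 one_ne_zero one_ne_zero
  rw [mul_one] at this; omega

theorem v_neg (h : WSetup v q μ ψ) (x : F) : v (-x) = v x := by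
  have h1 := h.hvmul (-1) (-1) (by simp) (by simp)
  have h2 := h.v_one
  rw [neg_mul_neg, mul_one] at h1
  by_cases hx : x = 0
  · simp [hx]
  · have := h.hvmul (-1) x (by simp) hx
    rw [neg_one_mul] at this; omega

theorem v_inv (h : WSetup v q μ ψ) {x : F} (hx : x ≠ 0) : v x⁻¹ = - v x := by
  have h1 := h.hvmul x x⁻¹ hx (inv_ne_zero hx)
  rw [mul_inv_cancel₀ hx, h.v_one] at h1; omega

theorem mem_add (h : WSetup v q μ ψ) {m : ℤ} {x y : F} (hx : x = 0 ∨ m ≤ v x)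
    (hy : y = 0 ∨ m ≤ v y) : x + y = 0 ∨ m ≤ v (x + y) := by
  by_cases hx0 : x = 0
  · subst hx0; simpa using hy
  by_cases hy0 : y = 0
  · subst hy0; simpa using hx
  by_cases hxy : x + y = 0
  · exact Or.inl hxy
  have := h.hvadd x y hx0 hy0 hxy
  right
  rcases hx with hx | hx
  · exact absurd hx hx0
  rcases hy with hy | hy
  · exact absurd hy hy0
  omega

theorem mem_neg (h : WSetup v q μ ψ) {m : ℤ} {x : F} :
    (-x = 0 ∨ m ≤ v (-x)) ↔ (x = 0 ∨ m ≤ v x) := by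
  rw [h.v_neg, neg_eq_zero]

theorem mem_mul (h : WSetup v q μ ψ) {m k : ℤ} {x y : F} (hx : x = 0 ∨ m ≤ v x)
    (hy : y = 0 ∨ k ≤ v y) : x * y = 0 ∨ m + k ≤ v (x * y) := by
  by_cases hx0 : x = 0
  · left; simp [hx0]
  by_cases hy0 : y = 0
  · left; simp [hy0]
  have := h.hvmul x y hx0 hy0
  right
  rcases hx with hx | hx
  · exact absurd hx hx0
  rcases hy with hy | hy
  · exact absurd hy hy0
  omega

theorem mem_mono {m k : ℤ} (hk : k ≤ m) {x : F} (hx : x = 0 ∨ m ≤ v x) : x = 0 ∨ k ≤ v x :=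
  hx.imp id (fun a => hk.trans a)

theorem mem_smul (h : WSetup v q μ ψ) {m : ℤ} {a x : F} (ha : a ≠ 0) :
    (a * x = 0 ∨ m ≤ v (a * x)) ↔ (x = 0 ∨ m - v a ≤ v x) := by
  by_cases hx0 : x = 0
  · simp [hx0]
  · rw [h.hvmul a x ha hx0]
    simp only [mul_eq_zero, ha, hx0, false_or]
    omega

/-- The ball as an additive subgroup. -/
def B (h : WSetup v q μ ψ) (m : ℤ) : AddSubgroup F where
  carrier := {x : F | x = 0 ∨ m ≤ v x}
  zero_mem' := Or.inl rfl
  add_mem' := fun hx hy => h.mem_add hx hy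
  neg_mem' := fun hx => h.mem_neg.2 hx

theorem mem_B (h : WSetup v q μ ψ) {m : ℤ} {x : F} : x ∈ h.B m ↔ (x = 0 ∨ m ≤ v x) := Iff.rfl

theorem wch_le {m : ℤ} {x : F} (hx : ¬ (x = 0 ∨ m ≤ v x)) : wch v m x = 0 := if_neg hx
theorem wch_of {m : ℤ} {x : F} (hx : (x = 0 ∨ m ≤ v x)) : wch v m x = 1 := if_pos hx
theorem wch_congr {m k : ℤ} {x y : F} (hxy : (x = 0 ∨ m ≤ v x) ↔ (y = 0 ∨ k ≤ v y)) :
    wch v m x = wch v k y := by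
  by_cases hx : x = 0 ∨ m ≤ v x
  · rw [wch_of hx, wch_of (hxy.1 hx)]
  · rw [wch_le hx, wch_le (fun a => hx (hxy.2 a))]

theorem wch_smul (h : WSetup v q μ ψ) {m : ℤ} {a x : F} (ha : a ≠ 0) :
    wch v m (a * x) = wch v (m - v a) x := by
  exact wch_congr (h.mem_smul ha)

theorem wch_neg (h : WSetup v q μ ψ) {m : ℤ} {x : F} : wch v m (-x) = wch v m x := by
  exact wch_congr h.mem_neg

theorem wch_add (h : WSetup v q μ ψ) {m : ℤ} {x s : F} (hs : s = 0 ∨ m ≤ v s) :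
    wch v m (x + s) = wch v m x := by
  have : (x + s ∈ h.B m) ↔ x ∈ h.B m := (h.B m).add_mem_cancel_right hs
  exact wch_congr this

theorem q_pos (h : WSetup v q μ ψ) : (q : ENNReal) ≠ 0 := by
  have := h.hq
  simp; omega

theorem ball_pos (h : WSetup v q μ ψ) (m : ℤ) : 0 < μ (h.B m : Set F) := by
  have : μ (h.B m : Set F) = (q : ENNReal) ^ (-m) := h.hball m
  rw [this]
  exact ENNReal.zpow_pos h.q_pos (by simp) _

theorem ball_fin (h : WSetup v q μ ψ) (m : ℤ) : μ (h.B m : Set F) < ⊤ := by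
  have : μ (h.B m : Set F) = (q : ENNReal) ^ (-m) := h.hball m
  rw [this]
  exact ENNReal.zpow_lt_top h.q_pos (by simp) _

theorem ball_real (h : WSetup v q μ ψ) (m : ℤ) : μ.real (h.B m : Set F) = (q : ℝ) ^ (-m) := by
  have : μ (h.B m : Set F) = (q : ENNReal) ^ (-m) := h.hball m
  rw [Measure.real, this]
  have hq := h.hq
  have hq0 : (q : NNReal) ≠ 0 := by
    simp; omega
  have e : (q : ENNReal) ^ (-m) = (((q : NNReal) ^ (-m) : NNReal) : ENNReal) := by
    rw [ENNReal.coe_zpow hq0]; simp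
  rw [e]; simp

theorem ball_meas (h : WSetup v q μ ψ) (m : ℤ) : MeasurableSet (h.B m : Set F) := h.hmb m

/-- cosets -/
def coset (h : WSetup v q μ ψ) (m : ℤ) (a : F) : Set F := (fun x => (-a) + x) ⁻¹' (h.B m : Set F)

theorem coset_meas (h : WSetup v q μ ψ) (m : ℤ) (a : F) : MeasurableSet (h.coset m a) :=
  (h.haar (-a)).measurable (h.ball_meas m)

theorem coset_measure (h : WSetup v q μ ψ) (m : ℤ) (a : F) :
    μ (h.coset m a) = μ (h.B m : Set F) :=
  (h.haar (-a)).measure_preimage (h.ball_meas m).nullMeasurableSet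

theorem countable_quot (h : WSetup v q μ ψ) [SigmaFinite μ] (m : ℤ) : Countable (F ⧸ h.B m) := by
  have := Measure.countable_meas_pos_of_disjoint_iUnion (μ := μ)
    (As := fun a : F ⧸ h.B m => h.coset m a.out) (fun a => h.coset_meas m _) (by
      intro a b hab
      refine Set.disjoint_left.2 fun x hx hy => hab ?_
      have e1 : ((a.out : F) : F ⧸ h.B m) = (x : F ⧸ h.B m) := QuotientAddGroup.eq.2 hx
      have e2 : ((b.out : F) : F ⧸ h.B m) = (x : F ⧸ h.B m) := QuotientAddGroup.eq.2 hy
      rw [← QuotientAddGroup.out_eq' a, ← QuotientAddGroup.out_eq' b, e1, e2])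
  have e : {i : F ⧸ h.B m | 0 < μ (h.coset m i.out)} = Set.univ := by
    ext i; simp only [Set.mem_ofPred_eq, Set.mem_univ, iff_true]
    rw [h.coset_measure]; exact h.ball_pos m
  rw [e] at this
  exact Set.countable_univ_iff.1 this

theorem meas_quot (h : WSetup v q μ ψ) [SigmaFinite μ] (m : ℤ) :
    @Measurable F (F ⧸ h.B m) _ ⊤ (fun x => (x : F ⧸ h.B m)) := by
  let _ : MeasurableSpace (F ⧸ h.B m) := ⊤
  have := h.countable_quot m
  refine measurable_to_countable' fun b => ?_
  have : (fun x : F => (x : F ⧸ h.B m)) ⁻¹' {b} = h.coset m b.out := by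
    ext x
    simp only [Set.mem_preimage, Set.mem_singleton_iff]
    rw [← QuotientAddGroup.out_eq' b, eq_comm, QuotientAddGroup.eq]
    simp [coset]
  rw [this]; exact h.coset_meas m _

theorem meas_inv (h : WSetup v q μ ψ) [SigmaFinite μ] (m : ℤ) (f : F → ℂ)
    (hf : ∀ x s, (s = 0 ∨ m ≤ v s) → f (x + s) = f x) : Measurable f := by
  let _ : MeasurableSpace (F ⧸ h.B m) := ⊤
  have := h.countable_quot m
  have : f = (fun z : F ⧸ h.B m => f z.out) ∘ (fun x : F => (x : F ⧸ h.B m)) := by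
    funext x
    have e := QuotientAddGroup.out_eq' (x : F ⧸ h.B m)
    have e2 := QuotientAddGroup.eq.1 e.symm
    have := hf x _ e2
    simp only [Function.comp]
    rw [← this]; congr 1; abel
  rw [this]
  exact Measurable.comp (fun _ _ => trivial) (h.meas_quot m)

theorem meas_inv2 (h : WSetup v q μ ψ) [SigmaFinite μ] (m : ℤ) (f : F → F → ℂ)
    (hf : ∀ x y s t, (s = 0 ∨ m ≤ v s) → (t = 0 ∨ m ≤ v t) → f (x + s) (y + t) = f x y) :
    Measurable (fun p : F × F => f p.1 p.2) := by
  let _ : MeasurableSpace (F ⧸ h.B m) := ⊤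
  have : DiscreteMeasurableSpace (F ⧸ h.B m) := ⟨fun _ => trivial⟩
  have := h.countable_quot m
  have : (fun p : F × F => f p.1 p.2) = (fun z : (F ⧸ h.B m) × (F ⧸ h.B m) => f z.1.out z.2.out) ∘
      (fun x : F × F => ((x.1 : F ⧸ h.B m), (x.2 : F ⧸ h.B m))) := by
    funext x
    have e := QuotientAddGroup.eq.1 (QuotientAddGroup.out_eq' (x.1 : F ⧸ h.B m)).symm
    have e' := QuotientAddGroup.eq.1 (QuotientAddGroup.out_eq' (x.2 : F ⧸ h.B m)).symm
    have := hf x.1 x.2 _ _ e e'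
    simp only [Function.comp]
    rw [← this]; congr 1 <;> abel
  rw [this]
  refine Measurable.comp (Measurable.of_discrete) ?_
  exact ((h.meas_quot m).comp measurable_fst).prodMk ((h.meas_quot m).comp measurable_snd)

theorem meas_wch (h : WSetup v q μ ψ) [SigmaFinite μ] (m : ℤ) : Measurable (wch v m) :=
  h.meas_inv m _ fun _ _ hs => h.wch_add hs

theorem meas_lin (h : WSetup v q μ ψ) [SigmaFinite μ] (a : F) :
    Measurable (fun x => ψ (a * x)) := by
  by_cases ha : a = 0
  · simp [ha]
  refine h.meas_inv (- v a) _ fun x s hs => ?_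
  rw [mul_add, h.hψadd, h.hψ1 (a * s), mul_one]
  rw [h.mem_smul ha]; simpa using hs


theorem meas_quad (h : WSetup v q μ ψ) [SigmaFinite μ] (t : F) (ht : t = 0 ∨ 0 ≤ v t) :
    Measurable (fun p : F × F => ψ (t * p.1 * p.2)) := by
  have key : ∀ m : ℕ, Measurable (fun p : F × F =>
      wch v (-m) p.1 * wch v (-m) p.2 * ψ (t * p.1 * p.2)) := by
    intro m
    refine h.meas_inv2 m (fun a b => wch v (-m) a * wch v (-m) b * ψ (t * a * b)) ?_
    intro x y s s' hs hs'
    have l : (-(m : ℤ)) ≤ m := by omega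
    rw [h.wch_add (mem_mono l hs), h.wch_add (mem_mono l hs')]
    by_cases hx : x = 0 ∨ (-(m : ℤ)) ≤ v x
    swap
    · simp [wch_le hx]
    by_cases hy : y = 0 ∨ (-(m : ℤ)) ≤ v y
    swap
    · simp [wch_le hy]
    congr 1
    have e : t * (x + s) * (y + s') = t * x * y + (t * x * s' + (t * s * y + t * s * s')) := by ring
    rw [e, h.hψadd, h.hψ1 (_ + _), mul_one]
    have h1 := h.mem_mul (h.mem_mul ht hx) hs'
    have h2 := h.mem_mul (h.mem_mul ht hs) hy
    have h3 := h.mem_mul (h.mem_mul ht hs) hs'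
    refine h.mem_add (mem_mono ?_ h1) (h.mem_add (mem_mono ?_ h2) (mem_mono ?_ h3)) <;> omega
  refine measurable_of_tendsto_metrizable key ?_
  rw [tendsto_pi_nhds]
  intro p
  refine tendsto_const_nhds.congr' ?_
  filter_upwards [Filter.eventually_ge_atTop ((v p.1).natAbs + (v p.2).natAbs)] with m hm
  rw [wch_of (Or.inr (by omega)), wch_of (Or.inr (by omega))]; simp

theorem ψ_zero (h : WSetup v q μ ψ) : ψ 0 = 1 := h.hψ1 0 (Or.inl rfl)

theorem ψ_mul_neg (h : WSetup v q μ ψ) (x : F) : ψ x * ψ (-x) = 1 := by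
  rw [← h.hψadd, add_neg_cancel, h.ψ_zero]

theorem ψ_nsmul (h : WSetup v q μ ψ) (x : F) (k : ℕ) : ψ (k • x) = ψ x ^ k := by
  induction k with
  | zero => simp [h.ψ_zero]
  | succ k ih => rw [succ_nsmul, h.hψadd, ih, pow_succ]

theorem norm_ψ_le (h : WSetup v q μ ψ) (x : F) : ‖ψ x‖ ≤ 1 := by
  by_contra hx
  push Not at hx
  set m : ℤ := min 0 (v x)
  have hxm : x ∈ h.B m := Or.inr (min_le_right _ _)
  have hd : Pairwise (Function.onFun Disjoint (fun k : ℕ => h.coset 0 (k • x))) := by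
    intro i j hij
    refine Set.disjoint_left.2 fun y hy hz => hij ?_
    have e : ∀ k : ℕ, y ∈ h.coset 0 (k • x) → ψ y = ψ x ^ k := by
      intro k hk
      have h1 := h.hψ1 _ hk
      have : y = k • x + (-(k • x) + y) := by abel
      rw [this, h.hψadd, h1, h.ψ_nsmul, mul_one]
    have e3 : ‖ψ x‖ ^ i = ‖ψ x‖ ^ j := by
      rw [← norm_pow, ← norm_pow, ← e i hy, ← e j hz]
    exact (pow_right_injective₀ (by linarith) hx.ne') e3
  have hle : μ (⋃ k : ℕ, h.coset 0 (k • x)) ≤ μ (h.B m : Set F) := by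
    refine measure_mono (Set.iUnion_subset fun k y hy => ?_)
    have h1 : -(k • x) + y ∈ h.B m := mem_mono (min_le_left _ _) hy
    have h2 : k • x ∈ h.B m := (h.B m).nsmul_mem hxm k
    have := (h.B m).add_mem h2 h1
    simpa using this
  rw [measure_iUnion hd (fun k => h.coset_meas _ _)] at hle
  simp only [h.coset_measure] at hle
  rw [ENNReal.tsum_const_eq_top_of_ne_zero (h.ball_pos 0).ne'] at hle
  exact absurd (h.ball_fin m) (not_lt.2 hle)

/-- translation as a measurable equivalence -/
def tr (h : WSetup v q μ ψ) (b : F) : F ≃ᵐ F where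
  toEquiv := Equiv.addLeft b
  measurable_toFun := (h.haar b).measurable
  measurable_invFun := (h.haar (-b)).measurable

theorem integral_tr (h : WSetup v q μ ψ) (b : F) (f : F → ℂ) :
    ∫ x, f (b + x) ∂μ = ∫ x, f x ∂μ :=
  MeasurePreserving.integral_comp (f := fun x => b + x) (h.haar b) (h.tr b).measurableEmbedding f

theorem wch_eq_ind (h : WSetup v q μ ψ) (m : ℤ) :
    wch v m = (h.B m : Set F).indicator (fun _ => (1 : ℂ)) := by
  funext x
  by_cases hx : x = 0 ∨ m ≤ v x
  · rw [wch_of hx, Set.indicator_of_mem]; exact hx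
  · rw [wch_le hx, Set.indicator_of_notMem]; exact hx

theorem integral_wch (h : WSetup v q μ ψ) (m : ℤ) : ∫ x, wch v m x ∂μ = (q : ℂ) ^ (-m) := by
  rw [h.wch_eq_ind, integral_indicator_const _ (h.ball_meas m), h.ball_real]
  simp

theorem integrable_wch (h : WSetup v q μ ψ) (m : ℤ) : Integrable (wch v m) μ := by
  rw [h.wch_eq_ind]
  exact (integrable_indicator_iff (h.ball_meas m)).2 (integrableOn_const (h.ball_fin m).ne)

theorem J0 (h : WSetup v q μ ψ) (m : ℤ) (a : F) :
    ∫ z, wch v m z * ψ (a * z) ∂μ = wch v (-m) a * (q : ℂ) ^ (-m) := by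
  by_cases ha : a = 0 ∨ -m ≤ v a
  · rw [wch_of ha, one_mul, ← h.integral_wch m]
    congr 1; funext z
    by_cases hz : z = 0 ∨ m ≤ v z
    · rw [h.hψ1 (a * z), mul_one]
      have := h.mem_mul ha hz
      simpa using this
    · simp [wch_le hz]
  · rw [wch_le ha, zero_mul]
    push Not at ha
    obtain ⟨ha0, hav⟩ := ha
    obtain ⟨x0, hx0, hx1, hx2⟩ := h.hψnt
    have e := h.integral_tr (x0 * a⁻¹) (fun z => wch v m z * ψ (a * z))
    have ht : x0 * a⁻¹ = 0 ∨ m ≤ v (x0 * a⁻¹) := by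
      right
      rw [h.hvmul _ _ hx0 (inv_ne_zero ha0), h.v_inv ha0]; omega
    have e2 : ∀ z, wch v m (x0 * a⁻¹ + z) * ψ (a * (x0 * a⁻¹ + z))
        = ψ x0 * (wch v m z * ψ (a * z)) := by
      intro z
      rw [add_comm, h.wch_add ht]
      have : a * (z + x0 * a⁻¹) = x0 + a * z := by field_simp; ring
      rw [this, h.hψadd]; ring
    simp only [e2] at e
    rw [integral_const_mul] at e
    have : (ψ x0 - 1) * ∫ z, wch v m z * ψ (a * z) ∂μ = 0 := by rw [sub_mul, e]; ring
    exact (mul_eq_zero.1 this).resolve_left (sub_ne_zero.2 hx2)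

theorem J (h : WSetup v q μ ψ) (m : ℤ) (a b : F) :
    ∫ z, wch v m (z - b) * ψ (a * z) ∂μ = wch v (-m) a * (ψ (a * b) * (q : ℂ) ^ (-m)) := by
  rw [← h.integral_tr b]
  have e2 : ∀ z, wch v m (b + z - b) * ψ (a * (b + z)) = ψ (a * b) * (wch v m z * ψ (a * z)) := by
    intro z
    rw [add_sub_cancel_left, mul_add, h.hψadd]; ring
  simp only [e2]
  rw [integral_const_mul, h.J0]; ring

theorem L2 (h : WSetup v q μ ψ) (k e : ℤ) (d n a : F) (hn : n ≠ 0) (hk : k ≤ e - v n) :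
    ∫ y, wch v k y * (wch v e (d + n * y) * ψ (a * y)) ∂μ
      = wch v (k + v n) d * (wch v (v n - e) a * (ψ (-(a * (d * n⁻¹))) * (q : ℂ) ^ (v n - e))) := by
  have e1 : ∀ y, wch v e (d + n * y) = wch v (e - v n) (y - (-(d * n⁻¹))) := by
    intro y
    rw [← h.wch_smul hn]; congr 1; field_simp; ring
  have e3 : wch v (k + v n) d = wch v k (d * n⁻¹) := by
    have : d = n * (d * n⁻¹) := by field_simp
    conv_lhs => rw [this]
    rw [h.wch_smul hn]; congr 1; ring
  have e2 : ∀ y, wch v k y * (wch v e (d + n * y) * ψ (a * y)) =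
      wch v (k + v n) d * (wch v (e - v n) (y - (-(d * n⁻¹))) * ψ (a * y)) := by
    intro y
    rw [e1, e3]
    by_cases hy : y - (-(d * n⁻¹)) = 0 ∨ (e - v n) ≤ v (y - (-(d * n⁻¹)))
    · have : y = -(d * n⁻¹) + (y - (-(d * n⁻¹))) := by ring
      have : wch v k y = wch v k (d * n⁻¹) := by
        rw [this, h.wch_add (mem_mono hk hy), h.wch_neg]
      rw [this]
    · rw [wch_le hy]; ring
  simp only [e2]
  rw [integral_const_mul, h.J]
  congr 2
  · congr 1; ring
  · rw [mul_neg]; congr 2; ring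

theorem pi2 {α : Type*} [MeasurableSpace α] (ν : Measure α) [SigmaFinite ν] (A B : α → ℂ) :
    ∫ w : Fin 2 → α, A (w 0) * B (w 1) ∂(Measure.pi fun _ : Fin 2 => ν)
      = (∫ a, A a ∂ν) * ∫ b, B b ∂ν := by
  have := integral_fintype_prod_eq_prod (𝕜 := ℂ) (E := fun _ : Fin 2 => α) (μ := fun _ => ν)
    (fun i => ![A, B] i)
  simpa [Fin.prod_univ_two] using this

theorem fub {α : Type*} [MeasurableSpace α] (ν : Measure α) [SigmaFinite ν] (K : α → α → ℂ)
    (hK : Integrable (fun p : α × α => K p.1 p.2) (ν.prod ν)) :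
    ∫ w : Fin 2 → α, K (w 0) (w 1) ∂(Measure.pi fun _ : Fin 2 => ν)
      = ∫ a, ∫ b, K a b ∂ν ∂ν := by
  rw [← integral_prod (fun p : α × α => K p.1 p.2) hK]
  exact (measurePreserving_piFinTwo (fun _ => ν)).integral_comp'
    (g := fun p : α × α => K p.1 p.2)

end WSetup

/-- The Weil-representation action of `[[1,0],[n,1]]` on the Schwartz
function `f = 1_{[[b₁+ϖᶜO, O],[b₂+ϖᶜO, O]]}` (fixed unit `u`, `b₁, b₂ ∈ O`), computed as
the double Fourier-type integral over `M₂(F)` with the determinant bilinear form: it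
equals `q^{2(j−c)}·ψ(u·n⁻¹·((x₁₁−b₁)x₂₂ − x₁₂(x₂₁−b₂)))` times the indicator of
`x₁₁ ∈ b₁+ϖʲO, x₂₁ ∈ b₂+ϖʲO, x₁₂ ∈ ϖ^{j−c}O, x₂₂ ∈ ϖ^{j−c}O`, where `j = v(n)`,
`0 ≤ j ≤ c`. -/
theorem stmt_17
    (F : Type*) [Field F] [MeasurableSpace F]
    (v : F → ℤ) (ϖ : F) (q : ℕ) (hq : 2 ≤ q)
    (hϖ0 : ϖ ≠ 0) (hϖv : v ϖ = 1)
    (hvmul : ∀ x y : F, x ≠ 0 → y ≠ 0 → v (x * y) = v x + v y)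
    (hvadd : ∀ x y : F, x ≠ 0 → y ≠ 0 → x + y ≠ 0 → min (v x) (v y) ≤ v (x + y))
    (μ : Measure F) [SigmaFinite μ]
    (haar : ∀ a : F, MeasurePreserving (fun x => a + x) μ μ)
    (hball : ∀ m : ℤ, μ {x : F | x = 0 ∨ m ≤ v x} = (q : ENNReal) ^ (-m))
    (hmb : ∀ m : ℤ, MeasurableSet {x : F | x = 0 ∨ m ≤ v x})
    (ψ : F → ℂ) (hψmeas : Measurable ψ)
    (hψadd : ∀ x y : F, ψ (x + y) = ψ x * ψ y)
    (hψ1 : ∀ x : F, (x = 0 ∨ 0 ≤ v x) → ψ x = 1)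
    (hψnt : ∃ x : F, x ≠ 0 ∧ -1 ≤ v x ∧ ψ x ≠ 1)
    (c : ℤ) (hc : 1 ≤ c)
    (u : F) (hu0 : u ≠ 0) (huv : v u = 0)
    (b₁ b₂ : F) (hb₁ : b₁ = 0 ∨ 0 ≤ v b₁) (hb₂ : b₂ = 0 ∨ 0 ≤ v b₂)
    (n : F) (hn0 : n ≠ 0) (hnv0 : 0 ≤ v n) (hnvc : v n ≤ c) :
    ∀ x : Fin 2 → Fin 2 → F,
      (∫ y, ((∫ z, Set.indicator
            {z : Fin 2 → Fin 2 → F |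
              (z 0 0 - b₁ = 0 ∨ c ≤ v (z 0 0 - b₁)) ∧ (z 1 0 - b₂ = 0 ∨ c ≤ v (z 1 0 - b₂)) ∧
              (z 0 1 = 0 ∨ 0 ≤ v (z 0 1)) ∧ (z 1 1 = 0 ∨ 0 ≤ v (z 1 1))}
            (fun z => ψ (u * (y 0 0 * z 1 1 + y 1 1 * z 0 0
              - y 0 1 * z 1 0 - y 1 0 * z 0 1))) z
            ∂(Measure.pi fun _ : Fin 2 => Measure.pi fun _ : Fin 2 => μ)) *
          ψ (-(u * n * (y 0 0 * y 1 1 - y 0 1 * y 1 0))) *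
          ψ (-(u * (x 0 0 * y 1 1 + x 1 1 * y 0 0 - x 0 1 * y 1 0 - x 1 0 * y 0 1))))
        ∂(Measure.pi fun _ : Fin 2 => Measure.pi fun _ : Fin 2 => μ))
      = Set.indicator
          {x : Fin 2 → Fin 2 → F |
            (x 0 0 - b₁ = 0 ∨ v n ≤ v (x 0 0 - b₁)) ∧ (x 1 0 - b₂ = 0 ∨ v n ≤ v (x 1 0 - b₂)) ∧
            (x 0 1 = 0 ∨ v n - c ≤ v (x 0 1)) ∧ (x 1 1 = 0 ∨ v n - c ≤ v (x 1 1))}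
          (fun x => (q : ℂ) ^ (2 * (v n - c)) *
            ψ (u * n⁻¹ * ((x 0 0 - b₁) * x 1 1 - x 0 1 * (x 1 0 - b₂)))) x := by
  intro x
  have h : WSetup v q μ ψ := ⟨hq, hvmul, hvadd, haar, hball, hmb, hψmeas, hψadd, hψ1, hψnt⟩
  have hqc : (q : ℂ) ≠ 0 := by
    simp; omega
  have hin : ∀ y : Fin 2 → Fin 2 → F, (∫ z, Set.indicator
            {z : Fin 2 → Fin 2 → F |
              (z 0 0 - b₁ = 0 ∨ c ≤ v (z 0 0 - b₁)) ∧ (z 1 0 - b₂ = 0 ∨ c ≤ v (z 1 0 - b₂)) ∧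
              (z 0 1 = 0 ∨ 0 ≤ v (z 0 1)) ∧ (z 1 1 = 0 ∨ 0 ≤ v (z 1 1))}
            (fun z => ψ (u * (y 0 0 * z 1 1 + y 1 1 * z 0 0
              - y 0 1 * z 1 0 - y 1 0 * z 0 1))) z
            ∂(Measure.pi fun _ : Fin 2 => Measure.pi fun _ : Fin 2 => μ))
      = wch v (-c) (y 1 1) * (ψ (u * y 1 1 * b₁) * (q : ℂ) ^ (-c)) * wch v 0 (y 1 0) *
        (wch v (-c) (y 0 1) * (ψ (-(u * y 0 1) * b₂) * (q : ℂ) ^ (-c)) * wch v 0 (y 0 0)) := by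
    intro y
    have e1 : ∀ z : Fin 2 → Fin 2 → F, Set.indicator
            {z : Fin 2 → Fin 2 → F |
              (z 0 0 - b₁ = 0 ∨ c ≤ v (z 0 0 - b₁)) ∧ (z 1 0 - b₂ = 0 ∨ c ≤ v (z 1 0 - b₂)) ∧
              (z 0 1 = 0 ∨ 0 ≤ v (z 0 1)) ∧ (z 1 1 = 0 ∨ 0 ≤ v (z 1 1))}
            (fun z => ψ (u * (y 0 0 * z 1 1 + y 1 1 * z 0 0
              - y 0 1 * z 1 0 - y 1 0 * z 0 1))) z =
        (fun w : Fin 2 → F => (fun t => wch v c (t - b₁) * ψ (u * y 1 1 * t)) (w 0) *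
          (fun t => wch v 0 (t - 0) * ψ (-(u * y 1 0) * t)) (w 1)) (z 0) *
        (fun w : Fin 2 → F => (fun t => wch v c (t - b₂) * ψ (-(u * y 0 1) * t)) (w 0) *
          (fun t => wch v 0 (t - 0) * ψ (u * y 0 0 * t)) (w 1)) (z 1) := by
      intro z
      simp only [sub_zero]
      by_cases h1 : z 0 0 - b₁ = 0 ∨ c ≤ v (z 0 0 - b₁)
      swap
      · rw [WSetup.wch_le h1, Set.indicator_of_notMem (fun hz => h1 hz.1)]; ring
      by_cases h2 : z 1 0 - b₂ = 0 ∨ c ≤ v (z 1 0 - b₂)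
      swap
      · rw [WSetup.wch_le h2, Set.indicator_of_notMem (fun hz => h2 hz.2.1)]; ring
      by_cases h3 : z 0 1 = 0 ∨ 0 ≤ v (z 0 1)
      swap
      · rw [WSetup.wch_le h3, Set.indicator_of_notMem (fun hz => h3 hz.2.2.1)]; ring
      by_cases h4 : z 1 1 = 0 ∨ 0 ≤ v (z 1 1)
      swap
      · rw [WSetup.wch_le h4, Set.indicator_of_notMem (fun hz => h4 hz.2.2.2)]; ring
      rw [Set.indicator_of_mem (by exact ⟨h1, h2, h3, h4⟩), WSetup.wch_of h1, WSetup.wch_of h2,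
        WSetup.wch_of h3, WSetup.wch_of h4]
      simp only [one_mul, ← hψadd]
      congr 1; ring
    rw [integral_congr_ae (Filter.Eventually.of_forall e1),
      WSetup.pi2 (Measure.pi fun _ : Fin 2 => μ)
        (fun w : Fin 2 → F => (fun t => wch v c (t - b₁) * ψ (u * y 1 1 * t)) (w 0) *
          (fun t => wch v 0 (t - 0) * ψ (-(u * y 1 0) * t)) (w 1))
        (fun w : Fin 2 → F => (fun t => wch v c (t - b₂) * ψ (-(u * y 0 1) * t)) (w 0) *
          (fun t => wch v 0 (t - 0) * ψ (u * y 0 0 * t)) (w 1)),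
      WSetup.pi2 μ (fun t => wch v c (t - b₁) * ψ (u * y 1 1 * t))
        (fun t => wch v 0 (t - 0) * ψ (-(u * y 1 0) * t)),
      WSetup.pi2 μ (fun t => wch v c (t - b₂) * ψ (-(u * y 0 1) * t))
        (fun t => wch v 0 (t - 0) * ψ (u * y 0 0 * t)),
      h.J, h.J, h.J, h.J]
    simp only [h.wch_smul hu0, h.wch_neg, huv, mul_zero, h.ψ_zero, neg_zero, zpow_zero, mul_one,
      sub_zero]
  -- the outer integrand as an iterated product
  set K : (Fin 2 → F) → (Fin 2 → F) → ℂ := fun a b =>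
    ((q : ℂ) ^ (-c) * (q : ℂ) ^ (-c)) *
      ((wch v 0 (a 0) * wch v (-c) (a 1)) * (wch v 0 (b 0) * wch v (-c) (b 1))) *
      (ψ (-(u * x 1 1) * a 0) * ψ (u * (x 1 0 - b₂) * a 1) * ψ (u * x 0 1 * b 0) *
        ψ (-(u * (x 0 0 - b₁)) * b 1) * ψ (u * n * a 1 * b 0) * ψ (-(u * n) * a 0 * b 1)) with hK
  have hout : ∀ y : Fin 2 → Fin 2 → F,
      (wch v (-c) (y 1 1) * (ψ (u * y 1 1 * b₁) * (q : ℂ) ^ (-c)) * wch v 0 (y 1 0) *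
        (wch v (-c) (y 0 1) * (ψ (-(u * y 0 1) * b₂) * (q : ℂ) ^ (-c)) * wch v 0 (y 0 0))) *
          ψ (-(u * n * (y 0 0 * y 1 1 - y 0 1 * y 1 0))) *
          ψ (-(u * (x 0 0 * y 1 1 + x 1 1 * y 0 0 - x 0 1 * y 1 0 - x 1 0 * y 0 1)))
      = K (y 0) (y 1) := by
    intro y
    have e : ψ (u * y 1 1 * b₁) * ψ (-(u * y 0 1) * b₂) *
          ψ (-(u * n * (y 0 0 * y 1 1 - y 0 1 * y 1 0))) *
          ψ (-(u * (x 0 0 * y 1 1 + x 1 1 * y 0 0 - x 0 1 * y 1 0 - x 1 0 * y 0 1)))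
        = ψ (-(u * x 1 1) * y 0 0) * ψ (u * (x 1 0 - b₂) * y 0 1) * ψ (u * x 0 1 * y 1 0) *
        ψ (-(u * (x 0 0 - b₁)) * y 1 1) * ψ (u * n * y 0 1 * y 1 0) *
          ψ (-(u * n) * y 0 0 * y 1 1) := by
      simp only [← hψadd]
      congr 1; ring
    simp only [hK]
    rw [← e]; ring
  have hunm : u * n = 0 ∨ 0 ≤ v (u * n) := by
    right; rw [hvmul _ _ hu0 hn0]; omega
  have hi : Integrable (fun p : (Fin 2 → F) × (Fin 2 → F) => K p.1 p.2)
      ((Measure.pi fun _ : Fin 2 => μ).prod (Measure.pi fun _ : Fin 2 => μ)) := by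
    have hg : Integrable (fun w : Fin 2 → F => wch v 0 (w 0) * wch v (-c) (w 1))
        (Measure.pi fun _ : Fin 2 => μ) := by
      have := Integrable.fintype_prod_dep (𝕜 := ℂ) (E := fun _ : Fin 2 => F) (μ := fun _ => μ)
        (f := fun i => ![wch v 0, wch v (-c)] i)
        (by intro i; fin_cases i <;> simp [h.integrable_wch])
      simpa [Fin.prod_univ_two] using this
    refine Integrable.mul_bdd (c := 1) ((hg.mul_prod hg).const_mul _) ?_ ?_
    · refine Measurable.aestronglyMeasurable ?_
      have c0 : ∀ i : Fin 2, Measurable (fun p : (Fin 2 → F) × (Fin 2 → F) => p.1 i) := fun i =>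
        (measurable_pi_apply i).comp measurable_fst
      have c1 : ∀ i : Fin 2, Measurable (fun p : (Fin 2 → F) × (Fin 2 → F) => p.2 i) := fun i =>
        (measurable_pi_apply i).comp measurable_snd
      exact ((((((h.meas_lin _).comp (c0 0)).mul ((h.meas_lin _).comp (c0 1))).mul
        ((h.meas_lin _).comp (c1 0))).mul ((h.meas_lin _).comp (c1 1))).mul
        ((h.meas_quad _ hunm).comp ((c0 1).prodMk (c1 0)))).mul
        ((h.meas_quad _ (h.mem_neg.2 hunm)).comp ((c0 0).prodMk (c1 1)))
    · refine Filter.Eventually.of_forall fun p => ?_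
      simp only [← hψadd]
      exact h.norm_ψ_le _
  simp only [hin, hout]
  rw [WSetup.fub _ K hi]
  have hrow : ∀ a : Fin 2 → F, (∫ b, K a b ∂(Measure.pi fun _ : Fin 2 => μ)) =
      (q : ℂ) ^ (-c) * ((fun t => wch v 0 t * (wch v c ((x 0 0 - b₁) + n * t) *
          ψ (-(u * x 1 1) * t))) (a 0) *
        (fun t => wch v (-c) t * (wch v 0 (x 0 1 + n * t) * ψ (u * (x 1 0 - b₂) * t))) (a 1)) := by
    intro a
    have e : ∀ b, K a b = ((q : ℂ) ^ (-c) * (q : ℂ) ^ (-c)) *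
        (wch v 0 (a 0) * ψ (-(u * x 1 1) * a 0) * (wch v (-c) (a 1) * ψ (u * (x 1 0 - b₂) * a 1))) *
        ((fun t => wch v 0 t * ψ (u * (x 0 1 + n * a 1) * t)) (b 0) *
         (fun t => wch v (-c) t * ψ (-(u * ((x 0 0 - b₁) + n * a 0)) * t)) (b 1)) := by
      intro b
      have e1 : ψ (u * (x 0 1 + n * a 1) * b 0) = ψ (u * x 0 1 * b 0) * ψ (u * n * a 1 * b 0) := by
        rw [← hψadd]; congr 1; ring
      have e2 : ψ (-(u * ((x 0 0 - b₁) + n * a 0)) * b 1) =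
          ψ (-(u * (x 0 0 - b₁)) * b 1) * ψ (-(u * n) * a 0 * b 1) := by
        rw [← hψadd]; congr 1; ring
      simp only [hK, e1, e2]; ring
    simp only [e]
    rw [integral_const_mul]
    rw [WSetup.pi2 μ (fun t => wch v 0 t * ψ (u * (x 0 1 + n * a 1) * t))
      (fun t => wch v (-c) t * ψ (-(u * ((x 0 0 - b₁) + n * a 0)) * t)), h.J0, h.J0]
    simp only [h.wch_smul hu0, h.wch_neg, huv, neg_zero, zpow_zero, mul_one, sub_zero, neg_neg]
    have : (q : ℂ) ^ (-c) * (q : ℂ) ^ c = 1 := by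
      rw [← zpow_add₀ hqc]; simp
    linear_combination ((q : ℂ) ^ (-c) * (wch v 0 (a 0) * ψ (-(u * x 1 1) * a 0) *
      (wch v (-c) (a 1) * ψ (u * (x 1 0 - b₂) * a 1))) * (wch v 0 (x 0 1 + n * a 1) *
        wch v c (x 0 0 - b₁ + n * a 0))) * this
  simp only [hrow]
  rw [integral_const_mul]
  rw [WSetup.pi2 μ (fun t => wch v 0 t * (wch v c ((x 0 0 - b₁) + n * t) *
          ψ (-(u * x 1 1) * t)))
      (fun t => wch v (-c) t * (wch v 0 (x 0 1 + n * t) * ψ (u * (x 1 0 - b₂) * t))),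
    h.L2 _ _ _ _ _ hn0 (by omega), h.L2 _ _ _ _ _ hn0 (by omega)]
  have hsum : -c + v n = v n - c := by ring
  simp only [h.wch_smul hu0, h.wch_neg, huv, sub_zero, zero_add, hsum]
  by_cases h1 : x 0 0 - b₁ = 0 ∨ v n ≤ v (x 0 0 - b₁)
  swap
  · rw [WSetup.wch_le h1, Set.indicator_of_notMem (fun hz => h1 hz.1)]; ring
  by_cases h2 : x 1 0 - b₂ = 0 ∨ v n ≤ v (x 1 0 - b₂)
  swap
  · rw [WSetup.wch_le h2, Set.indicator_of_notMem (fun hz => h2 hz.2.1)]; ring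
  by_cases h3 : x 0 1 = 0 ∨ v n - c ≤ v (x 0 1)
  swap
  · rw [WSetup.wch_le h3, Set.indicator_of_notMem (fun hz => h3 hz.2.2.1)]; ring
  by_cases h4 : x 1 1 = 0 ∨ v n - c ≤ v (x 1 1)
  swap
  · rw [WSetup.wch_le h4, Set.indicator_of_notMem (fun hz => h4 hz.2.2.2)]; ring
  rw [Set.indicator_of_mem (by exact ⟨h1, h2, h3, h4⟩), WSetup.wch_of h1, WSetup.wch_of h2,
    WSetup.wch_of h3, WSetup.wch_of h4]
  have eψ : ψ (u * n⁻¹ * ((x 0 0 - b₁) * x 1 1 - x 0 1 * (x 1 0 - b₂))) =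
      ψ (-(-(u * x 1 1) * ((x 0 0 - b₁) * n⁻¹))) * ψ (-(u * (x 1 0 - b₂) * (x 0 1 * n⁻¹))) := by
    rw [← hψadd]; congr 1; ring
  have eq1 : (q : ℂ) ^ (2 * (v n - c)) = (q : ℂ) ^ (-c) * (q : ℂ) ^ (v n - c) * (q : ℂ) ^ (v n) := by
    rw [← zpow_add₀ hqc, ← zpow_add₀ hqc]; congr 1; ring
  rw [eψ, eq1]; ring
end
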